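/- Cylinder stability lemma: let r = (R_j)_{j≥1} be a generic sequence of radii, let k_0 ≥ 1, and let ε = (ε_j)_{j≥2} (positive reals with ε_j < R_j), m = (m_j)_{j≥1}, ℓ = (ℓ_j)_{j≥2} be sequences such that condition (3.3) for k holds for every k > k_0 and condition (3.4) for k_0 holds. If c ∈ C(r), then for every c' ∈ Δ_{k_0+1}(c,ε) and every z ∈ ℂ_p, z lies in the cylinder C_c(α^{(k_0)}) if and only if z lies in the cylinder C_{c'}(α^{(k_0)}). -/

import Mathlib

noncomputable section

/-- `K` is a model of `ℂ_p`, the completion of an algebraic closure of `ℚ_p`: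
it is a complete, algebraically closed, nonarchimedean normed field whose norm
extends the `p`-adic absolute value and in which the algebraic elements over
`ℚ_p` are dense. -/
structure IsCp (p : ℕ) [Fact p.Prime] (K : Type*) [NormedField K] [Algebra ℚ_[p] K] : Prop where
  complete : CompleteSpace K
  norm_extends : ∀ x : ℚ_[p], ‖algebraMap ℚ_[p] K x‖ = ‖x‖
  isAlgClosed : IsAlgClosed K
  dense_algebraic : Dense {x : K | IsAlgebraic ℚ_[p] x}
  isNonarch : ∀ x y : K, ‖x + y‖ ≤ max ‖x‖ ‖y‖

/-- `ϱ = p^{-1/(p-1)}`. -/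
def rho (p : ℕ) : ℝ := (p : ℝ) ^ (-1 / ((p : ℝ) - 1))

/-- `R` is a sequence of radii: strictly increasing (for indices `≥ 1`),
with `R 1 > p`, tending to infinity. -/
def IsRadii (p : ℕ) (R : ℕ → ℝ) : Prop :=
  (∀ j, 1 ≤ j → R j < R (j + 1)) ∧ (p : ℝ) < R 1 ∧
    Filter.Tendsto R Filter.atTop Filter.atTop

/-- The piecewise-monomial map `φ`: for `R_{j-1} < t ≤ R_j` (with `R_0 := 0`),
`φ(t) = p (R_1 ⋯ R_{j-1})⁻¹ t^{p+j-1}`. -/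
def phi (p : ℕ) (R : ℕ → ℝ) (t : ℝ) : ℝ :=
  let j := sInf {j : ℕ | 1 ≤ j ∧ t ≤ R j}
  (p : ℝ) * (∏ i ∈ Finset.Icc 1 (j - 1), R i)⁻¹ * t ^ (p + j - 1)

/-- A generic sequence of radii. -/
def IsGenericRadii (p : ℕ) (R : ℕ → ℝ) : Prop :=
  IsRadii p R ∧ ∀ i j n : ℕ, 1 ≤ i → i < j → 1 ≤ n → (phi p R)^[n] (R i) ≠ R j

/-- Membership in the parameter space `C(r)`: `|c_j| = R_j` for all `j ≥ 1`. -/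
def InC (p : ℕ) [Fact p.Prime] {K : Type*} [NormedField K] (R : ℕ → ℝ) (c : ℕ → K) : Prop :=
  ∀ j, 1 ≤ j → ‖c j‖ = R j

/-- The transcendental entire map `f_c(z) = (z^p/p) ∏_{j ≥ 1} (1 - z/c_j)`. -/
def fc (p : ℕ) {K : Type*} [NormedField K] (c : ℕ → K) (z : K) : K :=
  z ^ p / (p : K) * ∏' j : ℕ, (1 - z / c (j + 1))

/-- The disk `B_0 = {|z| < 1}` for `j = 0`, and `B_j = {|z - c_j| < R_j}` for `j ≥ 1`. -/
def Bset {K : Type*} [NormedField K] (R : ℕ → ℝ) (c : ℕ → K) (j : ℕ) : Set K :=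
  if j = 0 then {z : K | ‖z‖ < 1} else {z : K | ‖z - c j‖ < R j}

/-- The set `A`, complement of all the disks `B_j`, `j ≥ 0`. -/
def Aset {K : Type*} [NormedField K] (R : ℕ → ℝ) (c : ℕ → K) : Set K :=
  (⋃ j, Bset R c j)ᶜ

/-- `n_j`, the minimal `n ≥ 1` with `R_j < φ^{∘(n+1)}(1)`. -/
def nseq (p : ℕ) (R : ℕ → ℝ) (j : ℕ) : ℕ :=
  sInf {n : ℕ | 1 ≤ n ∧ R j < (phi p R)^[n + 1] 1}

/-- `S_j = φ⁻¹(R_j)`. -/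
def Sse (p : ℕ) (R : ℕ → ℝ) (j : ℕ) : ℝ := Function.invFun (phi p R) (R j)

/-- `λ_j = φ(R_j)/R_j`. -/
def lam (p : ℕ) (R : ℕ → ℝ) (j : ℕ) : ℝ := phi p R (R j) / R j

/-- `L_k`: index of the first symbol of the `k`-th block `B_0^{m_k} A^{n_k} B_k^{…}`
of the itinerary `α(m, ℓ)`; `L_1 = 0` and `L_{k+1} = L_k + m_k + n_k + ℓ_{k+1}`. -/
def Lseq (m n l : ℕ → ℕ) : ℕ → ℕ
  | 0 => 0
  | 1 => 0
  | k + 2 => Lseq m n l (k + 1) + m (k + 1) + n (k + 1) + l (k + 2)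

/-- `N_k = L_k + m_k + n_k`, the index of the final symbol `B_k` of the truncated
itinerary `α^{(k)}` (so `α^{(k)}` has length `N_k + 1`). -/
def Nseq (m n l : ℕ → ℕ) (k : ℕ) : ℕ := Lseq m n l k + m k + n k

/-- The symbol (`some 0 = B_0`, `none = A`, `some k = B_k`) at position `i` of the
itinerary `α(m,ℓ) = B_0^{m_1} A^{n_1} B_1^{ℓ_2} B_0^{m_2} A^{n_2} B_2^{ℓ_3} ⋯`. -/
def itin (m n l : ℕ → ℕ) (i : ℕ) : Option ℕ :=
  let k := sSup {k : ℕ | 1 ≤ k ∧ Lseq m n l k ≤ i}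
  if i < Lseq m n l k + m k then some 0
  else if i < Lseq m n l k + m k + n k then none
  else some k

/-- The subset of `ℂ_p` corresponding to a symbol of the alphabet `{A, B_0, B_1, …}`. -/
def symbSet {K : Type*} [NormedField K] (R : ℕ → ℝ) (c : ℕ → K) : Option ℕ → Set K
  | none => Aset R c
  | some j => Bset R c j

/-- Condition (3.2) at `k`: `ϱ⁻¹ R_k p^{-m_k} λ_k^{ℓ_{k+1}} < 1`. -/
def Cond32 (p : ℕ) (R : ℕ → ℝ) (m l : ℕ → ℕ) (k : ℕ) : Prop :=
  (rho p)⁻¹ * R k * ((p : ℝ) ^ m k)⁻¹ * lam p R k ^ l (k + 1) < 1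

/-- Condition (3.3) for `k`: for all `2 ≤ j < k`,
`ε_k < ϱ^{k-j} R_k² (R_{j-1} S_{j-1})⁻¹ λ_{j-1}^{-ℓ_j}`. -/
def Cond33 (p : ℕ) (R : ℕ → ℝ) (ε : ℕ → ℝ) (l : ℕ → ℕ) (k : ℕ) : Prop :=
  ∀ j, 2 ≤ j → j < k →
    ε k < rho p ^ (k - j) * R k ^ 2 * (R (j - 1) * Sse p R (j - 1))⁻¹ *
      (lam p R (j - 1) ^ l j)⁻¹

/-- Condition (3.4) for `k`: for all `2 ≤ j ≤ k`,
`ϱ^{-2} R_{j-1} S_{j-1} λ_{j-1}^{ℓ_j} p^{-m_j} < 1`. -/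
def Cond34 (p : ℕ) (R : ℕ → ℝ) (m l : ℕ → ℕ) (k : ℕ) : Prop :=
  ∀ j, 2 ≤ j → j ≤ k →
    ((rho p) ^ 2)⁻¹ * (R (j - 1) * Sse p R (j - 1)) * lam p R (j - 1) ^ l j *
      ((p : ℝ) ^ m j)⁻¹ < 1

/-- Condition (3.5) at `k`: `p ϱ⁻¹ R_{k+1}² S_k⁻¹ λ_k^{-ℓ_{k+1}} < ε_{k+1}`. -/
def Cond35 (p : ℕ) (R : ℕ → ℝ) (ε : ℕ → ℝ) (l : ℕ → ℕ) (k : ℕ) : Prop :=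
  (p : ℝ) * (rho p)⁻¹ * R (k + 1) ^ 2 * (Sse p R k)⁻¹ * (lam p R k ^ l (k + 1))⁻¹ < ε (k + 1)

/-- `c' ∈ Δ_k(c, ε)`. -/
def InDelta (p : ℕ) [Fact p.Prime] {K : Type*} [NormedField K] (R : ℕ → ℝ) (c : ℕ → K)
    (ε : ℕ → ℝ) (k : ℕ) (c' : ℕ → K) : Prop :=
  InC p R c' ∧ (∀ j, 1 ≤ j → j < k → c' j = c j) ∧ ∀ j, k ≤ j → ‖c' j - c j‖ < ε j

/-- `c' ∈ U_k(c, ε)`. -/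
def InU (p : ℕ) [Fact p.Prime] {K : Type*} [NormedField K] (R : ℕ → ℝ) (c : ℕ → K)
    (k : ℕ) (ε : ℝ) (c' : ℕ → K) : Prop :=
  InC p R c' ∧ ‖c' k - c k‖ < ε ∧ ∀ j, 1 ≤ j → j ≠ k → c' j = c j

open Filter Topology

section Ultrametric

variable {K : Type*} [NormedField K] [IsUltrametricDist K]

lemma ultra_norm_add_le {x y : K} {C : ℝ} (hx : ‖x‖ ≤ C) (hy : ‖y‖ ≤ C) : ‖x + y‖ ≤ C :=
  (IsUltrametricDist.norm_add_le_max x y).trans (max_le hx hy)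

lemma ultra_norm_sub_le {x y : K} {C : ℝ} (hx : ‖x‖ ≤ C) (hy : ‖y‖ ≤ C) : ‖x - y‖ ≤ C := by
  rw [sub_eq_add_neg]
  exact ultra_norm_add_le hx (by rwa [norm_neg])

lemma norm_eq_of_norm_sub_lt {x y : K} (h : ‖y - x‖ < ‖x‖) : ‖y‖ = ‖x‖ := by
  have h1 := IsUltrametricDist.norm_add_eq_max_of_norm_ne_norm (x := y - x) (y := x) h.ne
  rwa [sub_add_cancel, max_eq_right h.le] at h1

lemma norm_sub_eq_max_of_ne {x y : K} (h : ‖x‖ ≠ ‖y‖) : ‖x - y‖ = max ‖x‖ ‖y‖ := by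
  have h1 := IsUltrametricDist.norm_add_eq_max_of_norm_ne_norm (x := x) (y := -y)
    (by rwa [norm_neg])
  rwa [norm_neg, ← sub_eq_add_neg] at h1

/-- A product of factors perturbed by relative errors at most `θ ≤ 1` is perturbed by a relative
error at most `θ`. -/
lemma norm_prod_sub_prod_le {ι : Type*} (s : Finset ι) (a b : ι → K) {θ : ℝ} (h0 : 0 ≤ θ)
    (h1 : θ ≤ 1) (h : ∀ i ∈ s, ‖b i - a i‖ ≤ θ * ‖a i‖) :
    ‖∏ i ∈ s, b i - ∏ i ∈ s, a i‖ ≤ θ * ‖∏ i ∈ s, a i‖ := by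
  classical
  induction s using Finset.induction_on with
  | empty => simpa using h0
  | insert j s hj ih =>
    rw [Finset.prod_insert hj, Finset.prod_insert hj]
    have ih := ih fun i hi => h i (Finset.mem_insert_of_mem hi)
    have hb : ‖∏ i ∈ s, b i‖ ≤ ‖∏ i ∈ s, a i‖ := by
      have := ultra_norm_add_le (C := ‖∏ i ∈ s, a i‖)
        (ih.trans (mul_le_of_le_one_left (norm_nonneg _) h1)) le_rfl
      rwa [sub_add_cancel] at this
    have e : b j * ∏ i ∈ s, b i - a j * ∏ i ∈ s, a i =
        (b j - a j) * ∏ i ∈ s, b i + a j * (∏ i ∈ s, b i - ∏ i ∈ s, a i) := by ring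
    rw [e, norm_mul]
    refine ultra_norm_add_le ?_ ?_
    · rw [norm_mul, ← mul_assoc]
      exact mul_le_mul (h j (Finset.mem_insert_self _ _)) hb (norm_nonneg _) (by positivity)
    · rw [norm_mul, mul_left_comm]
      exact mul_le_mul_of_nonneg_left ih (norm_nonneg _)

lemma norm_pow_sub_pow_le (n : ℕ) {z w : K} {η : ℝ} (h0 : 0 ≤ η) (h1 : η ≤ 1)
    (h : ‖w - z‖ ≤ η * ‖z‖) : ‖w ^ n - z ^ n‖ ≤ η * ‖z ^ n‖ := by
  simpa using norm_prod_sub_prod_le (Finset.range n) (fun _ => z) (fun _ => w) h0 h1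
    fun _ _ => h

/-- The `p`-th power map contracts small relative errors by the factor `1 / p`. -/
lemma norm_pow_prime_sub_pow_prime_le {p : ℕ} (hp : p.Prime) (hpK : ‖(p : K)‖ = (p : ℝ)⁻¹)
    {z w : K} {η : ℝ} (h0 : 0 ≤ η) (h1 : η ≤ 1) (hη : η ^ (p - 1) ≤ (p : ℝ)⁻¹)
    (h : ‖w - z‖ ≤ η * ‖z‖) : ‖w ^ p - z ^ p‖ ≤ η / p * ‖z ^ p‖ := by
  have hp1 := hp.one_lt
  have e := add_pow_prime_eq hp (w - z) z
  rw [sub_add_cancel] at e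
  rw [e, add_sub_right_comm, add_sub_cancel_right, norm_pow]
  refine ultra_norm_add_le ?_ ?_
  · rw [norm_pow]
    calc ‖w - z‖ ^ p ≤ (η * ‖z‖) ^ p := by gcongr
      _ = η ^ (p - 1) * (η * ‖z‖ ^ p) := by
        rw [mul_pow, ← mul_assoc, ← pow_succ, Nat.sub_add_cancel hp1.le]
      _ ≤ (p : ℝ)⁻¹ * (η * ‖z‖ ^ p) := by gcongr
      _ = η / p * ‖z‖ ^ p := by ring
  · have hs : ‖∑ k ∈ Finset.Ioo 0 p, (w - z) ^ (k - 1) * z ^ (p - k - 1) *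
        ((p.choose k / p : ℕ) : K)‖ ≤ ‖z‖ ^ (p - 2) := by
      refine IsUltrametricDist.norm_sum_le_of_forall_le_of_nonneg (by positivity) fun k hk => ?_
      rw [Finset.mem_Ioo] at hk
      have hwz : ‖w - z‖ ≤ ‖z‖ := h.trans (mul_le_of_le_one_left (norm_nonneg _) h1)
      rw [norm_mul, norm_mul, norm_pow, norm_pow]
      calc ‖w - z‖ ^ (k - 1) * ‖z‖ ^ (p - k - 1) * ‖((p.choose k / p : ℕ) : K)‖
          ≤ ‖z‖ ^ (k - 1) * ‖z‖ ^ (p - k - 1) * 1 := by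
            gcongr
            exact IsUltrametricDist.norm_natCast_le_one K _
        _ = ‖z‖ ^ (p - 2) := by
            rw [mul_one, ← pow_add]
            congr 1
            omega
    rw [norm_mul, norm_mul, norm_mul, hpK]
    calc (p : ℝ)⁻¹ * ‖w - z‖ * ‖z‖ * _ ≤ (p : ℝ)⁻¹ * (η * ‖z‖) * ‖z‖ * ‖z‖ ^ (p - 2) := by gcongr
      _ = η / p * (‖z‖ ^ (p - 2) * ‖z‖ * ‖z‖) := by ring
      _ = η / p * ‖z‖ ^ p := by
        rw [← pow_succ, ← pow_succ]
        congr 2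
        omega

lemma multipliable_one_sub_of_tendsto [CompleteSpace K] {ι : Type*} {a : ι → K}
    (ha : Tendsto (fun i => ‖a i‖) cofinite (𝓝 0)) : Multipliable fun i => 1 - a i := by
  classical
  have hfin : ∀ η : ℝ, 0 < η → {i | ¬ ‖a i‖ < η}.Finite := fun η hη =>
    (ha.eventually (gt_mem_nhds hη))
  set s₀ := (hfin 1 one_pos).toFinset
  set B := ‖∏ i ∈ s₀, (1 - a i)‖
  have hdiff : ∀ {s t : Finset ι} {θ : ℝ}, s ⊆ t → 0 ≤ θ → θ ≤ 1 → (∀ i ∉ s, ‖a i‖ ≤ θ) →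
      ‖∏ i ∈ t, (1 - a i) - ∏ i ∈ s, (1 - a i)‖ ≤ θ * ‖∏ i ∈ s, (1 - a i)‖ := by
    intro s t θ hst h0 h1 h
    have key := norm_prod_sub_prod_le (t \ s) (fun _ => (1 : K)) (fun i => 1 - a i) h0 h1
      fun i hi => by simpa using h i (Finset.mem_sdiff.1 hi).2
    rw [← Finset.prod_sdiff hst, ← sub_one_mul, norm_mul]
    refine mul_le_mul_of_nonneg_right ?_ (norm_nonneg _)
    simpa using key
  have hbound : ∀ s, s₀ ⊆ s → ‖∏ i ∈ s, (1 - a i)‖ ≤ B := by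
    intro s hs
    have h1 := hdiff (θ := 1) hs zero_le_one le_rfl fun i hi => by
      have : ‖a i‖ < 1 := by simpa [s₀] using hi
      exact this.le
    rw [one_mul] at h1
    have h2 := ultra_norm_add_le h1 le_rfl
    rwa [sub_add_cancel] at h2
  suffices CauchySeq fun s : Finset ι => ∏ i ∈ s, (1 - a i) by
    obtain ⟨x, hx⟩ := cauchySeq_tendsto_of_complete this
    exact ⟨x, hx⟩
  rw [Metric.cauchySeq_iff']
  intro e he
  have hB : 0 ≤ B := norm_nonneg _
  set θ := min 1 (e / (B + 1))
  have hθ : 0 < θ := by positivity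
  have hθ2 : θ * B < e := by
    calc θ * B ≤ e / (B + 1) * B := by gcongr; exact min_le_right _ _
      _ < e / (B + 1) * (B + 1) := by gcongr; linarith
      _ = e := by field_simp
  refine ⟨(hfin θ hθ).toFinset ∪ s₀, fun s hs => ?_⟩
  rw [dist_eq_norm]
  refine lt_of_le_of_lt (hdiff hs hθ.le (min_le_left _ _) fun i hi => ?_) ?_
  · have : ‖a i‖ < θ := by
      have := fun h => hi (Finset.mem_union_left _ h)
      simpa using this
    exact this.le
  · exact lt_of_le_of_lt (mul_le_mul_of_nonneg_left (hbound _ Finset.subset_union_right) hθ.le) hθ2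

end Ultrametric

section Radii

variable {p : ℕ} {R : ℕ → ℝ}

lemma IsRadii.strict (hR : IsRadii p R) {i j : ℕ} (hi : 1 ≤ i) (hij : i < j) : R i < R j := by
  induction j, hij using Nat.le_induction with
  | base => exact hR.1 i hi
  | succ j hj ih => exact ih.trans (hR.1 j (by omega))

lemma IsRadii.mono (hR : IsRadii p R) {i j : ℕ} (hi : 1 ≤ i) (hij : i ≤ j) : R i ≤ R j := by
  rcases hij.eq_or_lt with rfl | h
  · exact le_rfl
  · exact (hR.strict hi h).le

lemma IsRadii.prime_lt (hR : IsRadii p R) {j : ℕ} (hj : 1 ≤ j) : (p : ℝ) < R j :=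
  hR.2.1.trans_le (hR.mono le_rfl hj)

lemma IsRadii.pos (hR : IsRadii p R) {j : ℕ} (hj : 1 ≤ j) : 0 < R j :=
  (Nat.cast_nonneg p).trans_lt (hR.prime_lt hj)

lemma IsRadii.exists_le (hR : IsRadii p R) (t : ℝ) : ∃ n, t ≤ R (n + 1) :=
  ((tendsto_add_atTop_iff_nat 1).2 hR.2.2).eventually_ge_atTop t |>.exists

lemma phi_eq_prod_range (hR : IsRadii p R) {t : ℝ} {n : ℕ} (hn : t ≤ R (n + 1)) :
    phi p R t = p * t ^ p * ∏ i ∈ Finset.range n, max 1 (t / R (i + 1)) := by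
  have hne : {j : ℕ | 1 ≤ j ∧ t ≤ R j}.Nonempty := ⟨n + 1, by omega, hn⟩
  set J := sInf {j : ℕ | 1 ≤ j ∧ t ≤ R j} with hJ
  obtain ⟨hJ1, hJt⟩ : 1 ≤ J ∧ t ≤ R J := Nat.sInf_mem hne
  have hJn : J ≤ n + 1 := Nat.sInf_le ⟨by omega, hn⟩
  have hlt : ∀ i, 1 ≤ i → i < J → R i < t := fun i hi hiJ => by
    by_contra h
    exact Nat.notMem_of_lt_sInf hiJ ⟨hi, not_lt.1 h⟩
  obtain ⟨q, hq⟩ : ∃ q, J = q + 1 := ⟨J - 1, by omega⟩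
  have e1 : ∏ i ∈ Finset.range q, max 1 (t / R (i + 1)) =
      t ^ q * (∏ i ∈ Finset.range q, R (i + 1))⁻¹ := by
    rw [← Finset.prod_inv_distrib]
    calc _ = ∏ i ∈ Finset.range q, t * (R (i + 1))⁻¹ := by
          refine Finset.prod_congr rfl fun i hi => ?_
          rw [Finset.mem_range] at hi
          rw [← div_eq_mul_inv]
          refine max_eq_right ?_
          rw [one_le_div (hR.pos (by omega))]
          exact (hlt (i + 1) (by omega) (by omega)).le
      _ = _ := by rw [Finset.prod_mul_distrib, Finset.prod_const, Finset.card_range]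
  have e2 : ∏ i ∈ Finset.Ico q n, max 1 (t / R (i + 1)) = 1 := by
    refine Finset.prod_eq_one fun i hi => max_eq_left ?_
    rw [Finset.mem_Ico] at hi
    rw [div_le_one (hR.pos (by omega))]
    exact hJt.trans (hR.mono hJ1 (by omega))
  have e3 : ∏ i ∈ Finset.Icc 1 q, R i = ∏ i ∈ Finset.range q, R (i + 1) := by
    rw [Finset.range_eq_Ico, Finset.prod_Ico_add' R 0 q 1]
    rfl
  rw [← Finset.prod_range_mul_prod_Ico _ (show q ≤ n by omega), e1, e2]
  unfold phi
  simp only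
  rw [← hJ, hq, Nat.add_sub_cancel, e3, ← add_assoc, Nat.add_sub_cancel, pow_add]
  ring

lemma phi_eventually_eq_prod (hR : IsRadii p R) (t : ℝ) :
    ∀ᶠ s : Finset ℕ in atTop,
      p * t ^ p * ∏ i ∈ s, max 1 (t / R (i + 1)) = phi p R t := by
  obtain ⟨n, hn⟩ := hR.exists_le t
  filter_upwards [eventually_ge_atTop (Finset.range n)] with s hs
  rw [phi_eq_prod_range hR hn, Finset.prod_subset hs]
  intro i _ hi
  rw [Finset.mem_range, not_lt] at hi
  refine max_eq_left ?_
  rw [div_le_one (hR.pos (by omega))]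
  exact hn.trans (hR.mono (by omega) (by omega))

lemma phi_nonneg (hR : IsRadii p R) {t : ℝ} (ht : 0 ≤ t) : 0 ≤ phi p R t := by
  obtain ⟨n, hn⟩ := hR.exists_le t
  rw [phi_eq_prod_range hR hn]
  have : ∀ i ∈ Finset.range n, (0 : ℝ) ≤ max 1 (t / R (i + 1)) := fun i _ => by positivity
  have := Finset.prod_nonneg this
  positivity

lemma phi_eq_of_le_one (hR : IsRadii p R) (hp : 1 ≤ p) {t : ℝ} (ht : t ≤ 1) :
    phi p R t = p * t ^ p := by
  have h1 : (1 : ℝ) ≤ p := by exact_mod_cast hp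
  rw [phi_eq_prod_range hR (n := 0) (by linarith [hR.2.1])]
  simp

/-- `φ(t) / t` is increasing. -/
lemma mul_phi_le_mul_phi (hR : IsRadii p R) (hp : 1 ≤ p) {t u : ℝ} (ht : 0 ≤ t) (htu : t ≤ u) :
    u * phi p R t ≤ t * phi p R u := by
  obtain ⟨n, hn⟩ := hR.exists_le u
  rw [phi_eq_prod_range hR hn, phi_eq_prod_range hR (htu.trans hn)]
  have h1 : ∏ i ∈ Finset.range n, max 1 (t / R (i + 1)) ≤
      ∏ i ∈ Finset.range n, max 1 (u / R (i + 1)) := by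
    refine Finset.prod_le_prod (fun i _ => by positivity) fun i _ => ?_
    have := hR.pos (show 1 ≤ i + 1 by omega)
    gcongr
  have h0 : 0 ≤ ∏ i ∈ Finset.range n, max 1 (t / R (i + 1)) :=
    Finset.prod_nonneg fun i _ => by positivity
  have hu : 0 ≤ u := ht.trans htu
  obtain ⟨q, rfl⟩ : ∃ q, p = q + 1 := ⟨p - 1, by omega⟩
  calc _ = ((q + 1 : ℕ) : ℝ) * (t * u) * (t ^ q * ∏ i ∈ Finset.range n, max 1 (t / R (i + 1))) := by
        ring
    _ ≤ ((q + 1 : ℕ) : ℝ) * (t * u) * (u ^ q * ∏ i ∈ Finset.range n, max 1 (u / R (i + 1))) := by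
        gcongr
    _ = _ := by ring

lemma phi_pos (hR : IsRadii p R) (hp : 1 ≤ p) {t : ℝ} (ht : 0 < t) : 0 < phi p R t := by
  obtain ⟨n, hn⟩ := hR.exists_le t
  rw [phi_eq_prod_range hR hn]
  have : 0 < ∏ i ∈ Finset.range n, max 1 (t / R (i + 1)) :=
    Finset.prod_pos fun i _ => by positivity
  have hp' : (0 : ℝ) < p := by exact_mod_cast hp
  positivity

lemma phi_strictMono (hR : IsRadii p R) (hp : 1 ≤ p) {t u : ℝ} (ht : 0 ≤ t) (htu : t < u) :
    phi p R t < phi p R u := by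
  have hu : 0 < u := ht.trans_lt htu
  have h := mul_phi_le_mul_phi hR hp ht htu.le
  have h2 := phi_pos hR hp hu
  by_contra hcon
  have : u * phi p R u ≤ t * phi p R u := le_trans (by gcongr; linarith) h
  nlinarith

lemma le_of_phi_le (hR : IsRadii p R) (hp : 1 ≤ p) {t u : ℝ} (hu : 0 ≤ u)
    (h : phi p R t ≤ phi p R u) : t ≤ u :=
  le_of_not_gt fun hlt => (phi_strictMono hR hp hu hlt).not_ge h

lemma lt_phi (hR : IsRadii p R) (hp : 1 < p) {t : ℝ} (ht : 1 ≤ t) : t < phi p R t := by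
  have h := mul_phi_le_mul_phi hR hp.le zero_le_one ht
  rw [phi_eq_of_le_one hR hp.le le_rfl] at h
  have : (1 : ℝ) < p := by exact_mod_cast hp
  simp only [one_pow, mul_one, one_mul] at h
  nlinarith

lemma exists_phi_eq (hR : IsRadii p R) (hp : 1 < p) {k : ℕ} (hk : 1 ≤ k) :
    ∃ t, phi p R t = R k := by
  have hp1 : (1 : ℝ) < p := by exact_mod_cast hp
  have hRk := hR.prime_lt hk
  have hcont : ContinuousOn (phi p R) (Set.Icc 1 (R k)) := by
    have : ContinuousOn
        (fun t => p * t ^ p * ∏ i ∈ Finset.range k, max 1 (t / R (i + 1))) (Set.Icc 1 (R k)) := by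
      fun_prop
    exact this.congr fun t ht => phi_eq_prod_range hR (ht.2.trans (hR.1 k hk).le)
  obtain ⟨t, -, ht⟩ := intermediate_value_Icc (by linarith) hcont
    (show R k ∈ Set.Icc (phi p R 1) (phi p R (R k)) from
      ⟨by rw [phi_eq_of_le_one hR hp.le le_rfl]; simpa using hRk.le,
        (lt_phi hR hp (by linarith)).le⟩)
  exact ⟨t, ht⟩

lemma phi_Sse (hR : IsRadii p R) (hp : 1 < p) {k : ℕ} (hk : 1 ≤ k) :
    phi p R (Sse p R k) = R k :=
  Function.invFun_eq (exists_phi_eq hR hp hk)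

lemma one_le_Sse (hR : IsRadii p R) (hp : 1 < p) {k : ℕ} (hk : 1 ≤ k) (hS : 0 < Sse p R k) :
    1 ≤ Sse p R k := by
  refine le_of_phi_le hR hp.le hS.le ?_
  rw [phi_Sse hR hp hk, phi_eq_of_le_one hR hp.le le_rfl]
  simpa using (hR.prime_lt hk).le

lemma Sse_le (hR : IsRadii p R) (hp : 1 < p) {k : ℕ} (hk : 1 ≤ k) (hS : 0 < Sse p R k) :
    Sse p R k ≤ R k := by
  have := lt_phi hR hp (one_le_Sse hR hp hk hS)
  rw [phi_Sse hR hp hk] at this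
  exact this.le

lemma one_le_lam (hR : IsRadii p R) (hp : 1 < p) {k : ℕ} (hk : 1 ≤ k) : 1 ≤ lam p R k := by
  have hp1 : (1 : ℝ) < p := by exact_mod_cast hp
  have hRk := hR.prime_lt hk
  rw [lam, one_le_div (hR.pos hk)]
  exact (lt_phi hR hp (by linarith)).le

lemma radius_le_Sse_mul_lam (hR : IsRadii p R) (hp : 1 < p) {k : ℕ} (hk : 1 ≤ k)
    (hS : 0 < Sse p R k) : R k ≤ Sse p R k * lam p R k := by
  have h := mul_phi_le_mul_phi hR hp.le hS.le (Sse_le hR hp hk hS)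
  rw [phi_Sse hR hp hk] at h
  rw [lam, ← mul_div_assoc, le_div_iff₀ (hR.pos hk)]
  exact h

end Radii

section Rho

variable {p : ℕ}

lemma rho_pos (hp : 1 < p) : 0 < rho p :=
  Real.rpow_pos_of_pos (by exact_mod_cast (by omega : 0 < p)) _

lemma rho_lt_one (hp : 1 < p) : rho p < 1 := by
  have hp1 : (1 : ℝ) < p := by exact_mod_cast hp
  refine Real.rpow_lt_one_of_one_lt_of_neg hp1 ?_
  exact div_neg_of_neg_of_pos (by norm_num) (by linarith)

lemma rho_pow (hp : 1 < p) : rho p ^ (p - 1) = (p : ℝ)⁻¹ := by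
  have hp1 : (1 : ℝ) < p := by exact_mod_cast hp
  rw [rho, ← Real.rpow_natCast, ← Real.rpow_mul (by linarith), Nat.cast_sub hp.le, Nat.cast_one,
    div_mul_cancel₀ _ (by linarith), Real.rpow_neg_one]

lemma phi_le_rho {R : ℕ → ℝ} (hR : IsRadii p R) (hp : 1 < p) {t : ℝ} (h0 : 0 ≤ t)
    (ht : t ≤ rho p) : phi p R t ≤ rho p := by
  rw [phi_eq_of_le_one hR hp.le (ht.trans (rho_lt_one hp).le)]
  have hp0 : (p : ℝ) ≠ 0 := by exact_mod_cast (by omega : p ≠ 0)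
  calc (p : ℝ) * t ^ p ≤ p * rho p ^ p := by gcongr
    _ = p * (rho p ^ (p - 1) * rho p) := by rw [← pow_succ, Nat.sub_add_cancel hp.le]
    _ = rho p := by rw [rho_pow hp, ← mul_assoc, mul_inv_cancel₀ hp0, one_mul]

lemma lt_phi_iterate {R : ℕ → ℝ} (hR : IsRadii p R) (hp : 1 < p) {t : ℝ} (ht : 1 ≤ t) :
    ∀ d : ℕ, t < (phi p R)^[d + 1] t
  | 0 => lt_phi hR hp ht
  | d + 1 => by
    rw [Function.iterate_succ_apply']
    have := lt_phi_iterate hR hp ht d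
    exact this.trans (lt_phi hR hp (ht.trans this.le))

lemma phi_iterate_le_rho {R : ℕ → ℝ} (hR : IsRadii p R) (hp : 1 < p) {t : ℝ} (h0 : 0 ≤ t) (ht : t ≤ rho p)
    (d : ℕ) : 0 ≤ (phi p R)^[d] t ∧ (phi p R)^[d] t ≤ rho p := by
  induction d with
  | zero => exact ⟨h0, ht⟩
  | succ d ih =>
    rw [Function.iterate_succ_apply']
    exact ⟨phi_nonneg hR ih.1, phi_le_rho hR hp ih.1 ih.2⟩

end Rho

section Norm

variable {p : ℕ} {K : Type*} [NormedField K] {R : ℕ → ℝ} {c : ℕ → K}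

lemma norm_pow_div_prime (hpK : ‖(p : K)‖ = (p : ℝ)⁻¹) (z : K) :
    ‖z ^ p / (p : K)‖ = p * ‖z‖ ^ p := by
  rw [norm_div, norm_pow, hpK, div_inv_eq_mul, mul_comm]

lemma norm_one_sub_div_eq_max {z x : K} {r : ℝ} (hr : 0 < r) (hx : ‖x‖ = r)
    (hz : ‖z - x‖ = max ‖z‖ r) : ‖1 - z / x‖ = max 1 (‖z‖ / r) := by
  have hx0 : x ≠ 0 := norm_pos_iff.1 (hx ▸ hr)
  rw [one_sub_div hx0, norm_div, norm_sub_rev, hz, hx, ← max_div_div_right hr.le, div_self hr.ne',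
    max_comm]

lemma one_le_norm_of_mem_Aset {z : K} (hz : z ∈ Aset R c) : 1 ≤ ‖z‖ := by
  simp only [Aset, Set.mem_compl_iff, Set.mem_iUnion, not_exists] at hz
  have := hz 0
  rw [Bset, if_pos rfl] at this
  exact not_lt.1 this

end Norm

section Step

variable {p : ℕ} [Fact p.Prime] {K : Type*} [NormedField K] [IsUltrametricDist K]
  {R : ℕ → ℝ} {c c' : ℕ → K}

lemma norm_mul_sub_mul_le {a₁ a₂ b₁ b₂ : K} {θ : ℝ} (h0 : 0 ≤ θ) (h1 : θ ≤ 1)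
    (h₁ : ‖b₁ - a₁‖ ≤ θ * ‖a₁‖) (h₂ : ‖b₂ - a₂‖ ≤ θ * ‖a₂‖) :
    ‖b₁ * b₂ - a₁ * a₂‖ ≤ θ * ‖a₁ * a₂‖ := by
  have := norm_prod_sub_prod_le (Finset.univ : Finset (Fin 2)) ![a₁, a₂] ![b₁, b₂] h0 h1
    (by simpa [Fin.forall_fin_two] using ⟨h₁, h₂⟩)
  simpa only [Fin.prod_univ_two, Matrix.cons_val_zero, Matrix.cons_val_one] using this

lemma norm_sub_eq_max_of_norm_ne (hc : InC p R c) {j : ℕ} (hj : 1 ≤ j) {z : K}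
    (hz : ‖z‖ ≠ R j) : ‖z - c j‖ = max ‖z‖ (R j) := by
  rw [← hc j hj] at hz ⊢
  exact norm_sub_eq_max_of_ne hz

lemma norm_eq_of_norm_sub_center_lt (hc : InC p R c) {j : ℕ} (hj : 1 ≤ j) {z : K}
    (hz : ‖z - c j‖ < R j) : ‖z‖ = R j := by
  rw [← hc j hj] at hz ⊢
  exact norm_eq_of_norm_sub_lt hz

lemma norm_sub_eq_max_of_mem_Aset (hc : InC p R c) {z : K} (hz : z ∈ Aset R c)
    {j : ℕ} (hj : 1 ≤ j) : ‖z - c j‖ = max ‖z‖ (R j) := by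
  by_cases h : ‖z‖ = R j
  · refine le_antisymm (ultra_norm_sub_le (le_max_left _ _) (hc j hj ▸ le_max_right _ _)) ?_
    rw [h, max_self]
    simp only [Aset, Set.mem_compl_iff, Set.mem_iUnion, not_exists] at hz
    have := hz j
    rw [Bset, if_neg (by omega)] at this
    exact not_lt.1 this
  · exact norm_sub_eq_max_of_norm_ne hc hj h

lemma mem_Aset_of_norm_ne (hc : InC p R c) {z : K} (h1 : 1 ≤ ‖z‖)
    (hz : ∀ j, 1 ≤ j → ‖z‖ ≠ R j) : z ∈ Aset R c := by
  simp only [Aset, Set.mem_compl_iff, Set.mem_iUnion, not_exists]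
  intro j
  by_cases hj : j = 0
  · rw [Bset, if_pos hj]
    exact not_lt.2 h1
  · rw [Bset, if_neg hj]
    exact fun h => hz j (by omega) (norm_eq_of_norm_sub_center_lt hc (by omega) h)

lemma tendsto_fc [CompleteSpace K] (hR : IsRadii p R) (hc : InC p R c) (z : K) :
    Tendsto (fun s : Finset ℕ => z ^ p / (p : K) * ∏ j ∈ s, (1 - z / c (j + 1))) atTop
      (𝓝 (fc p c z)) := by
  have h : Tendsto (fun j => ‖z / c (j + 1)‖) cofinite (𝓝 0) := by
    rw [Nat.cofinite_eq_atTop]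
    have e : (fun j => ‖z / c (j + 1)‖) = fun j => ‖z‖ / R (j + 1) := by
      ext j
      rw [norm_div, hc (j + 1) (by omega)]
    rw [e]
    exact Tendsto.const_div_atTop ((tendsto_add_atTop_iff_nat 1).2 hR.2.2) _
  exact (multipliable_one_sub_of_tendsto h).hasProd.const_mul _

lemma norm_fc_eq_phi [CompleteSpace K] (hpK : ‖(p : K)‖ = (p : ℝ)⁻¹) (hR : IsRadii p R)
    (hc : InC p R c) {z : K} (hz : ∀ j, 1 ≤ j → ‖z - c j‖ = max ‖z‖ (R j)) :
    ‖fc p c z‖ = phi p R ‖z‖ := by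
  refine tendsto_nhds_unique (tendsto_fc hR hc z).norm (tendsto_const_nhds.congr' ?_)
  filter_upwards [phi_eventually_eq_prod hR ‖z‖] with s hs
  rw [← hs, norm_mul, norm_pow_div_prime hpK, norm_prod]
  congr 1
  refine Finset.prod_congr rfl fun i _ => ?_
  exact (norm_one_sub_div_eq_max (hR.pos (by omega)) (hc _ (by omega)) (hz _ (by omega))).symm

lemma norm_factor_sub_le {z w x x' : K} {r δ θ : ℝ} (hr : 0 < r) (hx : ‖x‖ = r) (hx' : ‖x'‖ = r)
    (hδ : ‖x' - x‖ ≤ δ * r ^ 2) (hz : ‖z - x‖ = max ‖z‖ r) (h0 : 0 ≤ θ) (h1 : ‖z‖ * δ ≤ θ)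
    (h2 : ‖w - z‖ / r ≤ θ * max 1 (‖z‖ / r)) :
    ‖(1 - w / x') - (1 - z / x)‖ ≤ θ * ‖1 - z / x‖ := by
  have hx0 : x ≠ 0 := norm_pos_iff.1 (hx ▸ hr)
  have hx0' : x' ≠ 0 := norm_pos_iff.1 (hx' ▸ hr)
  rw [norm_one_sub_div_eq_max hr hx hz]
  have e : (1 - w / x') - (1 - z / x) = z * (x' - x) / (x * x') + (z - w) / x' := by
    field_simp
    ring
  rw [e]
  refine ultra_norm_add_le ?_ ?_
  · rw [norm_div, norm_mul, norm_mul, hx, hx']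
    calc ‖z‖ * ‖x' - x‖ / (r * r) ≤ ‖z‖ * (δ * r ^ 2) / (r * r) := by gcongr
      _ = ‖z‖ * δ := by field_simp
      _ ≤ θ * 1 := by rwa [mul_one]
      _ ≤ _ := by gcongr; exact le_max_left _ _
  · rwa [norm_div, hx', norm_sub_rev]

/-- Comparison of `f_c` at a point `z` outside the disks `B_j`, `j ≥ 1`, with `f_{c'}` at a nearby
point `w`. -/
lemma norm_fc_sub_fc_le [CompleteSpace K] (hR : IsRadii p R)
    (hc : InC p R c) (hc' : InC p R c') {δ θ : ℝ}
    (hδ : ∀ j, 1 ≤ j → ‖c' j - c j‖ ≤ δ * R j ^ 2) {z w : K}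
    (hz : ∀ j, 1 ≤ j → ‖z - c j‖ = max ‖z‖ (R j)) (h0 : 0 ≤ θ) (hθ : θ ≤ 1)
    (hpow : ‖w ^ p - z ^ p‖ ≤ θ * ‖z ^ p‖) (h1 : ‖z‖ * δ ≤ θ)
    (h2 : ∀ j, 1 ≤ j → ‖w - z‖ / R j ≤ θ * max 1 (‖z‖ / R j)) :
    ‖fc p c' w - fc p c z‖ ≤ θ * ‖fc p c z‖ := by
  refine le_of_tendsto_of_tendsto' ((tendsto_fc hR hc' w).sub (tendsto_fc hR hc z)).norm
    ((tendsto_fc hR hc z).norm.const_mul θ) fun s => ?_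
  refine norm_mul_sub_mul_le h0 hθ ?_ (norm_prod_sub_prod_le s _ _ h0 hθ fun i _ => ?_)
  · rw [← sub_div, norm_div, norm_div, ← mul_div_assoc]
    gcongr
  · exact norm_factor_sub_le (hR.pos (by omega)) (hc _ (by omega)) (hc' _ (by omega))
      (hδ _ (by omega)) (hz _ (by omega)) h0 h1 (h2 _ (by omega))

/-- Comparison of `f_c` and `f_{c'}` on the disk `B_k`, on which `f_c` expands by `λ_k`. -/
lemma norm_fc_sub_fc_le_of_mem_ball [CompleteSpace K] (hpK : ‖(p : K)‖ = (p : ℝ)⁻¹)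
    (hR : IsRadii p R) (hc : InC p R c) (hc' : InC p R c') {δ : ℝ} (hδ0 : 0 ≤ δ)
    (hδ : ∀ j, 1 ≤ j → ‖c' j - c j‖ ≤ δ * R j ^ 2) {k : ℕ} (hk : 1 ≤ k) (hck : c' k = c k)
    (hRδ : R k * δ ≤ 1) {z w : K} (hz : ‖z - c k‖ < R k) (hw : ‖w - z‖ ≤ R k) :
    ‖fc p c' w - fc p c z‖ ≤ max (lam p R k * ‖w - z‖) (R k * δ * ‖fc p c z‖) := by
  have hzk : ‖z‖ = R k := norm_eq_of_norm_sub_center_lt hc hk hz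
  have hRk := hR.pos hk
  obtain ⟨q, rfl⟩ : ∃ q, k = q + 1 := ⟨k - 1, by omega⟩
  refine le_of_tendsto_of_tendsto ((tendsto_fc hR hc' w).sub (tendsto_fc hR hc z)).norm
    (tendsto_const_nhds.max ((tendsto_fc hR hc z).norm.const_mul (R (q + 1) * δ))) ?_
  filter_upwards [phi_eventually_eq_prod hR ‖z‖, eventually_ge_atTop {q}] with s hs hqs
  have hq : q ∈ s := hqs (Finset.mem_singleton_self q)
  set θ := max (‖w - z‖ / R (q + 1)) (R (q + 1) * δ) with hθdef
  have h0 : 0 ≤ θ := le_max_of_le_right (by positivity)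
  have hθ : θ ≤ 1 := max_le ((div_le_one hRk).2 hw) hRδ
  have hreg : ∀ i ∈ s.erase q, ‖z - c (i + 1)‖ = max ‖z‖ (R (i + 1)) := fun i hi => by
    refine norm_sub_eq_max_of_norm_ne hc (by omega) ?_
    rw [hzk]
    rcases lt_or_gt_of_ne (Finset.ne_of_mem_erase hi) with h | h
    · exact (hR.strict (by omega) (by omega)).ne'
    · exact (hR.strict (by omega) (by omega)).ne
  set G := z ^ p / (p : K) * ∏ j ∈ s.erase q, (1 - z / c (j + 1))
  set G' := w ^ p / (p : K) * ∏ j ∈ s.erase q, (1 - w / c' (j + 1))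
  have hG : ‖G‖ = phi p R (R (q + 1)) := by
    rw [← hzk, ← hs, norm_mul, norm_pow_div_prime hpK, norm_prod, ← Finset.mul_prod_erase s _ hq,
      hzk, div_self hRk.ne', max_self, one_mul]
    congr 1
    refine Finset.prod_congr rfl fun i hi => ?_
    rw [norm_one_sub_div_eq_max (hR.pos (by omega)) (hc _ (by omega)) (hreg i hi), hzk]
  have hGG : ‖G' - G‖ ≤ θ * ‖G‖ := by
    refine norm_mul_sub_mul_le h0 hθ ?_ (norm_prod_sub_prod_le _ _ _ h0 hθ fun i hi => ?_)
    · rw [← sub_div, norm_div, norm_div, ← mul_div_assoc]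
      gcongr
      refine norm_pow_sub_pow_le p h0 hθ ?_
      rw [hzk, ← div_le_iff₀ hRk]
      exact le_max_left _ _
    · have hRi := hR.pos (show 1 ≤ i + 1 by omega)
      refine norm_factor_sub_le hRi (hc _ (by omega)) (hc' _ (by omega))
        (hδ _ (by omega)) (hreg i hi) h0 (hzk ▸ le_max_right _ _) ?_
      calc ‖w - z‖ / R (i + 1) = ‖w - z‖ / R (q + 1) * (R (q + 1) / R (i + 1)) := by field_simp
        _ ≤ θ * max 1 (‖z‖ / R (i + 1)) := by
          rw [hzk]
          gcongr
          · exact le_max_left _ _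
          · exact le_max_right _ _
  have hlam : ‖G‖ * (‖w - z‖ / R (q + 1)) = lam p R (q + 1) * ‖w - z‖ := by
    rw [hG, lam]
    ring
  have hG' : ‖G'‖ ≤ ‖G‖ := by
    have := ultra_norm_add_le (hGG.trans (mul_le_of_le_one_left (norm_nonneg _) hθ)) le_rfl
    rwa [sub_add_cancel] at this
  have hc0 : c (q + 1) ≠ 0 := norm_pos_iff.1 (hc _ hk ▸ hRk)
  have hsmall : ‖1 - z / c (q + 1)‖ ≤ 1 := by
    rw [one_sub_div hc0, norm_div, norm_sub_rev, hc _ hk]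
    exact ((div_lt_one hRk).2 hz).le
  rw [← Finset.mul_prod_erase s _ hq, ← Finset.mul_prod_erase s _ hq, hck]
  have e1 : z ^ p / (p : K) * ((1 - z / c (q + 1)) * ∏ j ∈ s.erase q, (1 - z / c (j + 1))) =
      G * (1 - z / c (q + 1)) := by ring
  have e2 : w ^ p / (p : K) * ((1 - w / c (q + 1)) * ∏ j ∈ s.erase q, (1 - w / c' (j + 1))) =
      G' * (1 - w / c (q + 1)) := by ring
  have e3 : G' * (1 - w / c (q + 1)) - G * (1 - z / c (q + 1)) =
      G' * ((z - w) / c (q + 1)) + (G' - G) * (1 - z / c (q + 1)) := by ring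
  rw [e1, e2, e3]
  refine ultra_norm_add_le (le_max_of_le_left ?_) ?_
  · rw [norm_mul, norm_div, hc _ hk, norm_sub_rev, ← hlam]
    gcongr
  · rw [norm_mul, norm_mul]
    rcases le_total (‖w - z‖ / R (q + 1)) (R (q + 1) * δ) with h | h
    · rw [hθdef, max_eq_right h] at hGG
      refine le_max_of_le_right ?_
      rw [← mul_assoc]
      gcongr
    · rw [hθdef, max_eq_left h] at hGG
      refine le_max_of_le_left ?_
      rw [← hlam]
      calc ‖G' - G‖ * ‖1 - z / c (q + 1)‖ ≤ (‖w - z‖ / R (q + 1) * ‖G‖) * 1 := by gcongr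
        _ = _ := by ring

end Step

section Blocks

variable {p : ℕ} [Fact p.Prime] {K : Type*} [NormedField K] [IsUltrametricDist K]
  {R : ℕ → ℝ} {c c' : ℕ → K}

/-- Norms along an orbit segment of `f_c` avoiding the disks `B_j`, `j ≥ 1`, and ending in `B_k`. -/
lemma norm_orbit_climb [CompleteSpace K] (hpK : ‖(p : K)‖ = (p : ℝ)⁻¹)
    (hR : IsGenericRadii p R) (hc : InC p R c) {k : ℕ} (hk : 1 ≤ k) (hS : 0 < Sse p R k)
    {x : ℕ → K} (hx : ∀ i, x (i + 1) = fc p c (x i)) {N : ℕ}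
    (hreg : ∀ i, i < N → ∀ j, 1 ≤ j → ‖x i - c j‖ = max ‖x i‖ (R j))
    (hN : ‖x N - c k‖ < R k) :
    rho p < ‖x 0‖ ∧ ∀ i, i < N → ‖x i‖ ≤ Sse p R k ∧ ∀ j, 1 ≤ j → ‖x i‖ ≠ R j := by
  have hp : 1 < p := (Fact.out : p.Prime).one_lt
  have hp1 : (1 : ℝ) < p := by exact_mod_cast hp
  have hRk := hR.1.prime_lt hk
  have hnext : ∀ i, i < N → ‖x (i + 1)‖ = phi p R ‖x i‖ := fun i hi => by
    rw [hx, norm_fc_eq_phi hpK hR.1 hc (hreg i hi)]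
  have hiter : ∀ d i, i + d = N → (phi p R)^[d] ‖x i‖ = R k := by
    intro d
    induction d with
    | zero =>
      rintro i rfl
      exact norm_eq_of_norm_sub_center_lt hc hk hN
    | succ d ih =>
      intro i hi
      rw [Function.iterate_succ_apply, ← hnext i (by omega)]
      exact ih (i + 1) (by omega)
  have hlt : ∀ i, i < N → ‖x i‖ < R k := by
    intro i hi
    by_contra h
    have h' := not_lt.1 h
    obtain ⟨d, rfl⟩ : ∃ d, N = i + (d + 1) := ⟨N - i - 1, by omega⟩
    have := lt_phi_iterate hR.1 hp (t := ‖x i‖) (by linarith) d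
    rw [hiter _ i rfl] at this
    exact h this
  refine ⟨?_, fun i hi => ⟨?_, fun j hj hij => ?_⟩⟩
  · by_contra h
    have := (phi_iterate_le_rho hR.1 hp (norm_nonneg _) (not_lt.1 h) N).2
    rw [hiter N 0 (by omega)] at this
    linarith [rho_lt_one hp]
  · refine le_of_phi_le hR.1 hp.le hS.le ?_
    rw [phi_Sse hR.1 hp hk, ← hnext i hi]
    rcases Nat.lt_or_ge (i + 1) N with h | h
    · exact (hlt _ h).le
    · rw [show i + 1 = N by omega]
      exact (norm_eq_of_norm_sub_center_lt hc hk hN).le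
  · rcases Nat.lt_or_ge j k with h | h
    · refine hR.2 j k (N - i) hj h (by omega) ?_
      rw [← hij]
      exact hiter _ i (by omega)
    · have := hR.1.mono hk h
      linarith [hlt i hi]

/-- A relative error that dominates `S_k δ` is propagated along an orbit segment avoiding the
disks `B_j`, `j ≥ 1`. -/
lemma relative_error_climb [CompleteSpace K] (hR : IsRadii p R) (hc : InC p R c)
    (hc' : InC p R c') {δ : ℝ} (hδ0 : 0 ≤ δ) (hδ : ∀ j, 1 ≤ j → ‖c' j - c j‖ ≤ δ * R j ^ 2)
    {x y : ℕ → K} (hx : ∀ i, x (i + 1) = fc p c (x i)) (hy : ∀ i, y (i + 1) = fc p c' (y i))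
    {N a : ℕ} {S η : ℝ} (hreg : ∀ i, i < N → ∀ j, 1 ≤ j → ‖x i - c j‖ = max ‖x i‖ (R j))
    (hS : ∀ i, i < N → ‖x i‖ ≤ S) (h0 : 0 ≤ η) (h1 : η ≤ 1) (hη : S * δ ≤ η)
    (ha : ‖y a - x a‖ ≤ η * ‖x a‖) {i : ℕ} (hai : a ≤ i) (hi : i ≤ N) :
    ‖y i - x i‖ ≤ η * ‖x i‖ := by
  induction i, hai using Nat.le_induction with
  | base => exact ha
  | succ i hai ih =>
    have ih := ih (by omega)
    rw [hx, hy]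
    refine norm_fc_sub_fc_le hR hc hc' hδ (hreg i (by omega)) h0 h1
      (norm_pow_sub_pow_le p h0 h1 ih) (le_trans (by gcongr; exact hS i (by omega)) hη)
      fun j hj => ?_
    have := hR.pos hj
    calc ‖y i - x i‖ / R j ≤ η * ‖x i‖ / R j := by gcongr
      _ = η * (‖x i‖ / R j) := by ring
      _ ≤ _ := by gcongr; exact le_max_right _ _

/-- Inside `B_0` a relative error at most `ϱ` is contracted by `1 / p` at every step, until it is
dominated by the error due to the parameters. -/
lemma relative_error_unit_ball [CompleteSpace K] (hpK : ‖(p : K)‖ = (p : ℝ)⁻¹)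
    (hR : IsRadii p R) (hc : InC p R c)
    (hc' : InC p R c') {δ : ℝ} (hδ : ∀ j, 1 ≤ j → ‖c' j - c j‖ ≤ δ * R j ^ 2)
    {x y : ℕ → K} (hx : ∀ i, x (i + 1) = fc p c (x i)) (hy : ∀ i, y (i + 1) = fc p c' (y i))
    {m : ℕ} {η σ : ℝ} (hm : ∀ i, i < m → ‖x i‖ < 1)
    (h0 : 0 ≤ η) (hη : η ≤ rho p) (hσ : σ ≤ rho p) (hδ0 : 0 ≤ δ) (hδσ : δ ≤ σ)
    (hinit : ‖y 0 - x 0‖ ≤ η * ‖x 0‖) {i : ℕ} (hi : i ≤ m) :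
    ‖y i - x i‖ ≤ max (η / p ^ i) σ * ‖x i‖ := by
  have hp : 1 < p := (Fact.out : p.Prime).one_lt
  have hp1 : (1 : ℝ) < p := by exact_mod_cast hp
  have hρ := rho_lt_one hp
  induction i with
  | zero =>
    rw [pow_zero, div_one]
    exact hinit.trans (by gcongr; exact le_max_left _ _)
  | succ i ih =>
    have ih := ih (by omega)
    have hxi := hm i (by omega)
    set τ := max (η / p ^ i) σ with hτ
    have hτ0 : 0 ≤ τ := le_max_of_le_left (by positivity)
    have hτρ : τ ≤ rho p :=
      max_le ((div_le_self h0 (one_le_pow₀ hp1.le)).trans hη) hσ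
    have hσ0 : 0 ≤ σ := hδ0.trans hδσ
    have hτp : τ / p ≤ max (η / p ^ (i + 1)) σ := by
      rcases max_cases (η / (p : ℝ) ^ i) σ with ⟨h, -⟩ | ⟨h, -⟩
      · rw [hτ, h, pow_succ, div_div]
        exact le_max_left _ _
      · rw [hτ, h]
        exact le_max_of_le_right (div_le_self hσ0 hp1.le)
    have hle1 : max (η / (p : ℝ) ^ (i + 1)) σ ≤ 1 :=
      max_le ((div_le_self h0 (one_le_pow₀ hp1.le)).trans (hη.trans hρ.le)) (hσ.trans hρ.le)
    rw [hx, hy]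
    refine norm_fc_sub_fc_le hR hc hc' hδ (fun j hj => ?_)
      (le_max_of_le_right hσ0) hle1 ?_ ?_ fun j hj => ?_
    · refine norm_sub_eq_max_of_norm_ne hc hj ?_
      linarith [hR.prime_lt hj]
    · refine (norm_pow_prime_sub_pow_prime_le Fact.out hpK hτ0 (hτρ.trans hρ.le) ?_ ih).trans
        (by gcongr)
      rw [← rho_pow hp]
      gcongr
    · exact le_max_of_le_right ((mul_le_of_le_one_left hδ0 hxi.le).trans hδσ)
    · have hRj := hR.pos hj
      have hpj := hR.prime_lt hj
      calc ‖y i - x i‖ / R j ≤ τ * ‖x i‖ / R j := by gcongr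
        _ ≤ τ * 1 / p := by gcongr
        _ = τ / p * 1 := by ring
        _ ≤ _ := by
          gcongr
          exact le_max_left _ _

/-- Comparison of the orbits of `f_c` and `f_{c'}` along a segment with itinerary
`B_0^m A^n B_k`. -/
lemma orbit_climb_compare [CompleteSpace K] (hpK : ‖(p : K)‖ = (p : ℝ)⁻¹)
    (hR : IsGenericRadii p R) (hc : InC p R c) (hc' : InC p R c') {δ : ℝ} (hδ0 : 0 ≤ δ)
    (hδ : ∀ j, 1 ≤ j → ‖c' j - c j‖ ≤ δ * R j ^ 2) {k : ℕ} (hk : 1 ≤ k) (hck : c' k = c k)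
    (hS : 0 < Sse p R k) (hSδ : Sse p R k * δ < 1)
    {x y : ℕ → K} (hx : ∀ i, x (i + 1) = fc p c (x i)) (hy : ∀ i, y (i + 1) = fc p c' (y i))
    {m n : ℕ} (hm : ∀ i, i < m → ‖x i‖ < 1) (hn : ∀ i, m ≤ i → i < m + n → x i ∈ Aset R c)
    (hN : ‖x (m + n) - c k‖ < R k) (hinit : ‖y 0 - x 0‖ ≤ rho p) :
    (∀ i, i < m → ‖y i‖ < 1) ∧ (∀ i, m ≤ i → i < m + n → y i ∈ Aset R c') ∧
      ‖y (m + n) - c' k‖ < R k ∧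
      (Sse p R k * δ ≤ rho p → ‖y 0 - x 0‖ ≤ rho p ^ 2 → ‖y 0 - x 0‖ ≤ rho p ^ 2 * p ^ m * δ →
        ‖y (m + n) - x (m + n)‖ ≤ R k * Sse p R k * δ) := by
  have hp : 1 < p := (Fact.out : p.Prime).one_lt
  have hp1 : (1 : ℝ) < p := by exact_mod_cast hp
  have hρ0 := rho_pos hp
  have hρ1 := rho_lt_one hp
  have hreg : ∀ i, i < m + n → ∀ j, 1 ≤ j → ‖x i - c j‖ = max ‖x i‖ (R j) := by
    intro i hi j hj
    rcases Nat.lt_or_ge i m with h | h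
    · refine norm_sub_eq_max_of_norm_ne hc hj ?_
      linarith [hR.1.prime_lt hj, hm i h]
    · exact norm_sub_eq_max_of_mem_Aset hc (hn i h hi) hj
  obtain ⟨hx0, hnorm⟩ := norm_orbit_climb hpK hR hc hk hS hx hreg hN
  have hxN : ‖x (m + n)‖ = R k := norm_eq_of_norm_sub_center_lt hc hk hN
  have hx0' : 0 < ‖x 0‖ := hρ0.trans hx0
  set η := max (‖y 0 - x 0‖ / ‖x 0‖) (Sse p R k * δ)
  have hη0 : 0 ≤ η := le_max_of_le_left (by positivity)
  have hη1 : η < 1 := max_lt ((div_lt_one hx0').2 (hinit.trans_lt hx0)) hSδ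
  have hrel : ∀ i, i ≤ m + n → ‖y i - x i‖ ≤ η * ‖x i‖ := fun i hi =>
    relative_error_climb hR.1 hc hc' hδ0 hδ hx hy hreg (fun i hi => (hnorm i hi).1) hη0 hη1.le
      (le_max_right _ _) (by rw [← div_le_iff₀ hx0']; exact le_max_left _ _) (Nat.zero_le i) hi
  have hpos : ∀ i, i ≤ m + n → 0 < ‖x i‖ := by
    intro i hi
    rcases Nat.lt_or_ge i (m + n) with h | h
    · refine norm_pos_iff.2 fun h0 => ?_
      have hz : ∀ d, x (i + d) = 0 := by
        intro d
        induction d with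
        | zero => exact h0
        | succ d ih =>
          rw [← add_assoc, hx, ih, fc, zero_pow (by omega), zero_div, zero_mul]
      have := hz (m + n - i)
      rw [Nat.add_sub_cancel' hi] at this
      rw [this, norm_zero] at hxN
      exact (hR.1.pos hk).ne hxN
    · rw [show i = m + n by omega, hxN]
      exact hR.1.pos hk
  have hyx : ∀ i, i ≤ m + n → ‖y i‖ = ‖x i‖ := fun i hi =>
    norm_eq_of_norm_sub_lt ((hrel i hi).trans_lt (mul_lt_of_lt_one_left (hpos i hi) hη1))
  refine ⟨fun i hi => ?_, fun i hmi hi => ?_, ?_, fun hSρ h2 h3 => ?_⟩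
  · rw [hyx i (by omega)]
    exact hm i hi
  · refine mem_Aset_of_norm_ne hc' ?_ ?_
    · rw [hyx i hi.le]
      exact one_le_norm_of_mem_Aset (hn i hmi hi)
    · rw [hyx i hi.le]
      exact (hnorm i hi).2
  · rw [hck, ← sub_add_sub_cancel (y (m + n)) (x (m + n)) (c k)]
    refine (IsUltrametricDist.norm_add_le_max _ _).trans_lt (max_lt ?_ hN)
    rw [← hxN]
    exact (hrel _ le_rfl).trans_lt (mul_lt_of_lt_one_left (hpos _ le_rfl) hη1)
  · have hS1 := one_le_Sse hR.1 hp hk hS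
    have hδS : δ ≤ Sse p R k * δ := le_mul_of_one_le_left hδ0 hS1
    have hηρ : ‖y 0 - x 0‖ / rho p ≤ rho p := by
      rw [div_le_iff₀ hρ0, ← pow_two]
      exact h2
    have hstart : ‖y m - x m‖ ≤ Sse p R k * δ * ‖x m‖ := by
      refine (relative_error_unit_ball hpK hR.1 hc hc' hδ hx hy hm (by positivity) hηρ hSρ hδ0 hδS
        ?_ le_rfl).trans ?_
      · rw [div_mul_eq_mul_div, le_div_iff₀ hρ0]
        gcongr
      · gcongr
        refine max_le (le_trans ?_ hδS) le_rfl
        rw [div_div, div_le_iff₀ (by positivity)]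
        calc ‖y 0 - x 0‖ ≤ rho p ^ 2 * p ^ m * δ := h3
          _ = rho p * (δ * (rho p * p ^ m)) := by ring
          _ ≤ 1 * (δ * (rho p * p ^ m)) := by gcongr
          _ = _ := one_mul _
    have := relative_error_climb hR.1 hc hc' hδ0 hδ hx hy hreg (fun i hi => (hnorm i hi).1)
      (by positivity) hSδ.le le_rfl hstart (Nat.le_add_right m n) le_rfl
    rw [hxN] at this
    linarith

/-- Comparison of the orbits of `f_c` and `f_{c'}` along a segment with itinerary `B_k^l`. -/
lemma orbit_stay_compare [CompleteSpace K] (hpK : ‖(p : K)‖ = (p : ℝ)⁻¹)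
    (hR : IsRadii p R) (hc : InC p R c) (hc' : InC p R c') {δ : ℝ} (hδ0 : 0 ≤ δ)
    (hδ : ∀ j, 1 ≤ j → ‖c' j - c j‖ ≤ δ * R j ^ 2) {k : ℕ} (hk : 1 ≤ k) (hck : c' k = c k)
    (hS : 0 < Sse p R k)
    {x y : ℕ → K} (hx : ∀ i, x (i + 1) = fc p c (x i)) (hy : ∀ i, y (i + 1) = fc p c' (y i))
    {l : ℕ} (hl : ∀ i, i < l → ‖x i - c k‖ < R k) (hlast : ‖x l‖ ≤ R k)
    (hinit : ‖y 0 - x 0‖ ≤ R k * Sse p R k * δ)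
    (hXδ : R k * Sse p R k * lam p R k ^ l * δ ≤ 1) {i : ℕ} (hi : i ≤ l) :
    ‖y i - x i‖ ≤ R k * Sse p R k * lam p R k ^ i * δ := by
  have hp : 1 < p := (Fact.out : p.Prime).one_lt
  have hp1 : (1 : ℝ) < p := by exact_mod_cast hp
  have hRk := hR.pos hk
  have hRp := hR.prime_lt hk
  have hlam := one_le_lam hR hp hk
  have hS1 := one_le_Sse hR hp hk hS
  have hsmall : ∀ i, i ≤ l → R k * Sse p R k * lam p R k ^ i * δ ≤ 1 := fun i hi =>
    le_trans (by gcongr) hXδ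
  have hRδ : R k * δ ≤ 1 := by
    refine le_trans ?_ (hsmall 0 (Nat.zero_le _))
    rw [pow_zero, mul_one]
    gcongr
    exact le_mul_of_one_le_right hRk.le hS1
  have hxle : ∀ i, i ≤ l → ‖x i‖ ≤ R k := by
    intro i hi
    rcases hi.eq_or_lt with rfl | h
    · exact hlast
    · exact (norm_eq_of_norm_sub_center_lt hc hk (hl i h)).le
  induction i with
  | zero => simpa using hinit
  | succ i ih =>
    have ih := ih (by omega)
    have hnext := hxle (i + 1) hi
    rw [hx] at hnext
    rw [hx, hy]
    refine (norm_fc_sub_fc_le_of_mem_ball hpK hR hc hc' hδ0 hδ hk hck hRδ (hl i (by omega))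
      (ih.trans ((hsmall i (by omega)).trans (by linarith)))).trans (max_le ?_ ?_)
    · calc lam p R k * ‖y i - x i‖ ≤ lam p R k * (R k * Sse p R k * lam p R k ^ i * δ) := by gcongr
        _ = _ := by ring
    · calc R k * δ * ‖fc p c (x i)‖ ≤ R k * δ * R k := by gcongr
        _ ≤ R k * δ * (Sse p R k * lam p R k) := by
          gcongr
          exact radius_le_Sse_mul_lam hR hp hk hS
        _ = R k * Sse p R k * (1 * lam p R k) * δ := by ring
        _ ≤ R k * Sse p R k * (lam p R k ^ i * lam p R k) * δ := by
          gcongr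
          exact one_le_pow₀ hlam
        _ = _ := by ring

end Blocks

section Itinerary

variable {m n l : ℕ → ℕ}

lemma Lseq_succ (m n l : ℕ → ℕ) {k : ℕ} (hk : 1 ≤ k) :
    Lseq m n l (k + 1) = Nseq m n l k + l (k + 1) := by
  obtain ⟨q, rfl⟩ : ∃ q, k = q + 1 := ⟨k - 1, by omega⟩
  rfl

lemma Lseq_mono (m n l : ℕ → ℕ) {k k' : ℕ} (hk : 1 ≤ k) (h : k ≤ k') :
    Lseq m n l k ≤ Lseq m n l k' := by
  induction k', h using Nat.le_induction with
  | base => exact le_rfl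
  | succ k' h ih =>
    rw [Lseq_succ m n l (by omega), Nseq]
    omega

lemma itin_eq {k i : ℕ} (hk : 1 ≤ k) (h1 : Lseq m n l k ≤ i) (h2 : i < Lseq m n l (k + 1)) :
    itin m n l i = if i < Lseq m n l k + m k then some 0
      else if i < Lseq m n l k + m k + n k then none else some k := by
  have : sSup {k : ℕ | 1 ≤ k ∧ Lseq m n l k ≤ i} = k := by
    refine IsGreatest.csSup_eq ⟨⟨hk, h1⟩, fun k' hk' => ?_⟩
    by_contra hlt
    have := Lseq_mono m n l (show 1 ≤ k + 1 by omega) (show k + 1 ≤ k' by omega)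
    have := hk'.2
    omega
  simp only [itin, this]

end Itinerary

lemma mem_Bset_zero {K : Type*} [NormedField K] {R : ℕ → ℝ} {c : ℕ → K} {z : K} :
    z ∈ symbSet R c (some 0) ↔ ‖z‖ < 1 := by
  simp [symbSet, Bset]

lemma mem_Bset_of_pos {K : Type*} [NormedField K] {R : ℕ → ℝ} {c : ℕ → K} {z : K} {k : ℕ}
    (hk : 1 ≤ k) : z ∈ symbSet R c (some k) ↔ ‖z - c k‖ < R k := by
  simp [symbSet, Bset, show k ≠ 0 by omega]

/-- Orbits with the prescribed truncated itinerary keep it under a perturbation of the parameter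
whose size is measured by `δ`. -/
lemma cylinder_subset {p : ℕ} [Fact p.Prime] {K : Type*} [NormedField K] [IsUltrametricDist K]
    [CompleteSpace K] (hpK : ‖(p : K)‖ = (p : ℝ)⁻¹) {R : ℕ → ℝ} (hR : IsGenericRadii p R)
    {k₀ : ℕ} (hk₀ : 1 ≤ k₀) {m n l : ℕ → ℕ} (hm : ∀ j, 1 ≤ j → 1 ≤ m j) (hl : ∀ j, 2 ≤ j → 1 ≤ l j)
    {c c' : ℕ → K} (hc : InC p R c) (hc' : InC p R c') (hcc : ∀ j, 1 ≤ j → j ≤ k₀ → c' j = c j)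
    {δ : ℝ} (hδ0 : 0 < δ) (hδ : ∀ j, 1 ≤ j → ‖c' j - c j‖ ≤ δ * R j ^ 2)
    (hS : ∀ j, 1 ≤ j → 0 < Sse p R j) (hδR : R (k₀ + 1) * δ ≤ 1)
    (h33 : ∀ k, 1 ≤ k → k < k₀ →
      R k * Sse p R k * lam p R k ^ l (k + 1) * δ ≤ rho p ^ (k₀ - k))
    (h34 : ∀ k, 1 ≤ k → k < k₀ →
      R k * Sse p R k * lam p R k ^ l (k + 1) ≤ rho p ^ 2 * p ^ m (k + 1)) {z : K}
    (hz : ∀ i, i ≤ Nseq m n l k₀ → (fc p c)^[i] z ∈ symbSet R c (itin m n l i)) :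
    ∀ i, i ≤ Nseq m n l k₀ → (fc p c')^[i] z ∈ symbSet R c' (itin m n l i) := by
  have hp : 1 < p := (Fact.out : p.Prime).one_lt
  have hp1 : (1 : ℝ) < p := by exact_mod_cast hp
  have hρ0 := rho_pos hp
  have hρ1 := rho_lt_one hp
  set x : ℕ → K := fun i => (fc p c)^[i] z
  set y : ℕ → K := fun i => (fc p c')^[i] z
  have hx : ∀ i, x (i + 1) = fc p c (x i) := fun i => Function.iterate_succ_apply' _ _ _
  have hy : ∀ i, y (i + 1) = fc p c' (y i) := fun i => Function.iterate_succ_apply' _ _ _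
  have hNlt : ∀ k, 1 ≤ k → Nseq m n l k < Lseq m n l (k + 1) := fun k hk => by
    rw [Lseq_succ m n l hk]
    have := hl (k + 1) (by omega)
    omega
  have hNle : ∀ k, 1 ≤ k → k ≤ k₀ → Nseq m n l k ≤ Nseq m n l k₀ := by
    intro k hk hkk
    rcases hkk.eq_or_lt with rfl | h
    · exact le_rfl
    · have h1 := hNlt k hk
      have h2 := Lseq_mono m n l (show 1 ≤ k + 1 by omega) h
      have h3 : Lseq m n l k₀ ≤ Nseq m n l k₀ := by
        rw [Nseq]
        omega
      omega
  have hSδ : ∀ k, 1 ≤ k → k ≤ k₀ → Sse p R k * δ < 1 := fun k hk hkk => by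
    refine lt_of_lt_of_le ?_ hδR
    gcongr
    exact (Sse_le hR.1 hp hk (hS k hk)).trans_lt (hR.1.strict hk (by omega))
  have climb : ∀ k, 1 ≤ k → k ≤ k₀ → ‖y (Lseq m n l k) - x (Lseq m n l k)‖ ≤ rho p →
      (∀ i, Lseq m n l k ≤ i → i ≤ Nseq m n l k → y i ∈ symbSet R c' (itin m n l i)) ∧
      (Sse p R k * δ ≤ rho p → ‖y (Lseq m n l k) - x (Lseq m n l k)‖ ≤ rho p ^ 2 →
        ‖y (Lseq m n l k) - x (Lseq m n l k)‖ ≤ rho p ^ 2 * p ^ m k * δ →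
        ‖y (Nseq m n l k) - x (Nseq m n l k)‖ ≤ R k * Sse p R k * δ) := by
    intro k hk hkk hinit
    have hlt := hNlt k hk
    have hle := hNle k hk hkk
    have hNk : Nseq m n l k = Lseq m n l k + (m k + n k) := by
      rw [Nseq, add_assoc]
    have hsym : ∀ i, i ≤ m k + n k → itin m n l (Lseq m n l k + i) =
        if i < m k then some 0 else if i < m k + n k then none else some k := by
      intro i hi
      rw [itin_eq hk (by omega) (by omega), add_assoc]
      simp only [add_lt_add_iff_left]
    have hz' : ∀ i, i ≤ m k + n k → x (Lseq m n l k + i) ∈ symbSet R c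
        (if i < m k then some 0 else if i < m k + n k then none else some k) := by
      intro i hi
      rw [← hsym i hi]
      exact hz _ (by omega)
    obtain ⟨h1, h2, h3, h4⟩ := orbit_climb_compare hpK hR hc hc' hδ0.le hδ hk (hcc k hk hkk)
      (hS k hk) (hSδ k hk hkk) (x := fun i => x (Lseq m n l k + i))
      (y := fun i => y (Lseq m n l k + i)) (fun i => hx _) (fun i => hy _) (m := m k) (n := n k)
      (fun i hi => by
        have := hz' i (by omega)
        rwa [if_pos hi, mem_Bset_zero] at this)
      (fun i hi hi' => by
        have := hz' i (by omega)
        rwa [if_neg (by omega), if_pos hi'] at this)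
      (by
        have := hz' (m k + n k) le_rfl
        rwa [if_neg (by omega), if_neg (by omega), mem_Bset_of_pos hk] at this) hinit
    refine ⟨fun i hi hi' => ?_, ?_⟩
    · obtain ⟨d, rfl⟩ := Nat.exists_eq_add_of_le hi
      rw [hsym d (by omega)]
      by_cases hd : d < m k
      · rw [if_pos hd, mem_Bset_zero]
        exact h1 d hd
      · by_cases hd' : d < m k + n k
        · rw [if_neg hd, if_pos hd']
          exact h2 d (by omega) hd'
        · rw [if_neg hd, if_neg hd', mem_Bset_of_pos hk, show d = m k + n k by omega]
          exact h3
    · rw [hNk]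
      exact h4
  have blocks : ∀ k, 1 ≤ k → k ≤ k₀ →
      (∀ i, i < Lseq m n l k → y i ∈ symbSet R c' (itin m n l i)) ∧
      ‖y (Lseq m n l k) - x (Lseq m n l k)‖ ≤ rho p ^ (k₀ + 1 - k) ∧
      ‖y (Lseq m n l k) - x (Lseq m n l k)‖ ≤ rho p ^ 2 * p ^ m k * δ := by
    intro k hk
    induction k, hk using Nat.le_induction with
    | base =>
      intro _
      have h0 : ‖y (Lseq m n l 1) - x (Lseq m n l 1)‖ = 0 := by
        simp [Lseq, x, y]
      rw [h0]
      exact ⟨fun i hi => absurd hi (Nat.not_lt_zero i), by positivity, by positivity⟩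
    | succ k hk ih =>
      intro hkk
      obtain ⟨hmem, hsmall, hsmall'⟩ := ih (by omega)
      have hlt := hNlt k hk
      have hL := Lseq_succ m n l hk
      have hlam := one_le_lam hR.1 hp hk
      have hRk := hR.1.prime_lt hk
      have hRk0 := hR.1.pos hk
      have hSk := hS k hk
      have hX := h33 k hk (by omega)
      have hle := hNle (k + 1) (by omega) hkk
      have hLN : Lseq m n l (k + 1) ≤ Nseq m n l (k + 1) := by
        rw [Nseq]
        omega
      have hXρ : R k * Sse p R k * lam p R k ^ l (k + 1) * δ ≤ rho p :=
        hX.trans (pow_le_of_le_one hρ0.le hρ1.le (by omega))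
      obtain ⟨hclimb, hentry⟩ := climb k hk (by omega)
        (hsmall.trans (pow_le_of_le_one hρ0.le hρ1.le (by omega)))
      have hentry := hentry
        (by
          refine le_trans ?_ hXρ
          gcongr
          calc Sse p R k = 1 * Sse p R k * 1 := by ring
            _ ≤ R k * Sse p R k * lam p R k ^ l (k + 1) := by
              gcongr
              · linarith
              · exact one_le_pow₀ hlam)
        (hsmall.trans (pow_le_pow_of_le_one hρ0.le hρ1.le (by omega))) hsmall'
      have hsym : ∀ i, i < l (k + 1) → itin m n l (Nseq m n l k + i) = some k := by
        intro i hi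
        rw [itin_eq hk (by rw [Nseq]; omega) (by omega), if_neg (by rw [Nseq]; omega),
          if_neg (by rw [Nseq]; omega)]
      have hball : ∀ i, i < l (k + 1) → ‖x (Nseq m n l k + i) - c k‖ < R k := by
        intro i hi
        rw [← mem_Bset_of_pos hk, ← hsym i hi]
        exact hz _ (by omega)
      have hlast : ‖x (Nseq m n l k + l (k + 1))‖ ≤ R k := by
        have hmk := hm (k + 1) (by omega)
        have hmemz := hz (Lseq m n l (k + 1)) (by omega)
        rw [itin_eq (by omega) le_rfl
          (lt_of_le_of_lt hLN (hNlt (k + 1) (by omega))), if_pos (by omega), mem_Bset_zero] at hmemz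
        rw [← hL]
        exact hmemz.le.trans (by linarith)
      have hstay := fun i (hi : i ≤ l (k + 1)) =>
        orbit_stay_compare hpK hR.1 hc hc' hδ0.le hδ hk (hcc k hk (by omega)) hSk
          (x := fun i => x (Nseq m n l k + i)) (y := fun i => y (Nseq m n l k + i))
          (fun i => hx _) (fun i => hy _) hball hlast hentry (hXρ.trans hρ1.le) hi
      refine ⟨fun i hi => ?_, ?_, ?_⟩
      · rcases Nat.lt_or_ge i (Lseq m n l k) with h | h
        · exact hmem i h
        rcases Nat.lt_or_ge i (Nseq m n l k) with h' | h'
        · exact hclimb i h h'.le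
        obtain ⟨d, rfl⟩ := Nat.exists_eq_add_of_le h'
        have hd : d < l (k + 1) := by omega
        rw [hsym d hd, mem_Bset_of_pos hk, hcc k hk (by omega),
          ← sub_add_sub_cancel _ (x (Nseq m n l k + d)) (c k)]
        refine (IsUltrametricDist.norm_add_le_max _ _).trans_lt (max_lt ?_ (hball d hd))
        calc _ ≤ R k * Sse p R k * lam p R k ^ d * δ := hstay d hd.le
          _ ≤ R k * Sse p R k * lam p R k ^ l (k + 1) * δ := by gcongr
          _ < R k := by linarith
      · rw [hL, show k₀ + 1 - (k + 1) = k₀ - k by omega]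
        exact (hstay _ le_rfl).trans hX
      · rw [hL]
        exact (hstay _ le_rfl).trans
          (mul_le_mul_of_nonneg_right (h34 k hk (by omega)) hδ0.le)
  intro i hi
  obtain ⟨hmem, hsmall, -⟩ := blocks k₀ hk₀ le_rfl
  rcases Nat.lt_or_ge i (Lseq m n l k₀) with h | h
  · exact hmem i h
  · rw [Nat.add_sub_cancel_left, pow_one] at hsmall
    exact (climb k₀ hk₀ le_rfl hsmall).1 i h hi

/-- The upper bounds on `ε` force the chosen preimages `S_j` to be positive. -/
lemma Sse_pos_of_cond33 {p : ℕ} (hp : 1 < p) {R : ℕ → ℝ} (hR : IsRadii p R) {k₀ : ℕ} {ε : ℕ → ℝ}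
    (hε : ∀ j, 2 ≤ j → 0 < ε j) {l : ℕ → ℕ} (h33 : ∀ k, k₀ < k → Cond33 p R ε l k) {j : ℕ}
    (hj : 1 ≤ j) : 0 < Sse p R j := by
  have h := h33 (k₀ + j + 2) (by omega) (j + 1) (by omega) (by omega)
  rw [Nat.add_sub_cancel] at h
  by_contra hS
  have hRj := hR.pos hj
  have hlam : 0 < lam p R j := zero_lt_one.trans_le (one_le_lam hR hp hj)
  have hρ := rho_pos hp
  have h1 : (R j * Sse p R j)⁻¹ ≤ 0 :=
    inv_nonpos.2 (mul_nonpos_of_nonneg_of_nonpos hRj.le (not_lt.1 hS))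
  have h2 := mul_nonpos_of_nonpos_of_nonneg
    (mul_nonpos_of_nonneg_of_nonpos
      (show 0 ≤ rho p ^ (k₀ + j + 2 - (j + 1)) * R (k₀ + j + 2) ^ 2 by positivity) h1)
    (show 0 ≤ (lam p R j ^ l (j + 1))⁻¹ by positivity)
  exact absurd (hε (k₀ + j + 2) (by omega)) (not_lt.2 (h.le.trans h2))

/-- **Lemma 3.6** (Cylinder stability). If (3.3) holds for every `k > k₀` and (3.4) holds
for `k₀`, then for `c' ∈ Δ_{k₀+1}(c, ε)` the cylinders of the truncated itinerary
`α^{(k₀)}` for `f_c` and for `f_{c'}` coincide. -/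
theorem cylinder_stability
    (p : ℕ) [Fact p.Prime] (K : Type*) [NontriviallyNormedField K] [Algebra ℚ_[p] K]
    (hK : IsCp p K) (R : ℕ → ℝ) (hR : IsGenericRadii p R)
    (k₀ : ℕ) (hk₀ : 1 ≤ k₀)
    (ε : ℕ → ℝ) (hε : ∀ j, 2 ≤ j → 0 < ε j ∧ ε j < R j)
    (m : ℕ → ℕ) (hm : ∀ j, 1 ≤ j → 1 ≤ m j)
    (l : ℕ → ℕ) (hl : ∀ j, 2 ≤ j → 1 ≤ l j)
    (h33 : ∀ k, k₀ < k → Cond33 p R ε l k)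
    (h34 : Cond34 p R m l k₀)
    (c : ℕ → K) (hc : InC p R c)
    (c' : ℕ → K) (hc' : InDelta p R c ε (k₀ + 1) c') :
    ∀ z : K,
      (∀ i, i ≤ Nseq m (nseq p R) l k₀ →
          (fc p c)^[i] z ∈ symbSet R c (itin m (nseq p R) l i)) ↔
      (∀ i, i ≤ Nseq m (nseq p R) l k₀ →
          (fc p c')^[i] z ∈ symbSet R c' (itin m (nseq p R) l i)) := by
  have hp : 1 < p := (Fact.out : p.Prime).one_lt
  have : CompleteSpace K := hK.complete
  have : IsUltrametricDist K :=
    IsUltrametricDist.isUltrametricDist_of_forall_norm_add_le_max_norm hK.isNonarch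
  have hpK : ‖(p : K)‖ = (p : ℝ)⁻¹ := by
    have := hK.norm_extends p
    rwa [map_natCast, Padic.norm_p] at this
  have hρ0 := rho_pos hp
  have hρ1 := rho_lt_one hp
  have hS : ∀ j, 1 ≤ j → 0 < Sse p R j := fun j hj =>
    Sse_pos_of_cond33 hp hR.1 (fun j hj => (hε j hj).1) h33 hj
  have hXpos : ∀ k, 1 ≤ k → 0 < R k * Sse p R k * lam p R k ^ l (k + 1) := fun k hk => by
    have h1 := hR.1.pos hk
    have h2 := hS k hk
    have h3 : 0 < lam p R k := zero_lt_one.trans_le (one_le_lam hR.1 hp hk)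
    positivity
  set g : ℕ → ℝ := fun i => ε (k₀ + 1 + i) / R (k₀ + 1 + i) ^ 2 with hg
  have hgR : ∀ i, g i ≤ 1 / R (k₀ + 1) := fun i => by
    have h1 := hR.1.pos (show 1 ≤ k₀ + 1 + i by omega)
    have h2 := hR.1.pos (show 1 ≤ k₀ + 1 by omega)
    calc g i ≤ R (k₀ + 1 + i) / R (k₀ + 1 + i) ^ 2 := by
          simp only [hg]
          gcongr
          exact (hε _ (by omega)).2.le
      _ = 1 / R (k₀ + 1 + i) := by field_simp
      _ ≤ 1 / R (k₀ + 1) := by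
          gcongr
          exact hR.1.mono (by omega) (by omega)
  have hbdd : BddAbove (Set.range g) := ⟨1 / R (k₀ + 1), by rintro _ ⟨i, rfl⟩; exact hgR i⟩
  set δ := ⨆ i, g i
  have hgδ : ∀ i, g i ≤ δ := le_ciSup hbdd
  have hδ0 : 0 < δ := by
    refine lt_of_lt_of_le ?_ (hgδ 0)
    have h1 := hR.1.pos (show 1 ≤ k₀ + 1 + 0 by omega)
    have h2 := (hε (k₀ + 1 + 0) (by omega)).1
    simp only [hg]
    positivity
  have hδR : R (k₀ + 1) * δ ≤ 1 := by
    have h2 := hR.1.pos (show 1 ≤ k₀ + 1 by omega)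
    rw [mul_comm, ← le_div_iff₀ h2]
    exact ciSup_le hgR
  have hδX : ∀ k, 1 ≤ k → k < k₀ →
      R k * Sse p R k * lam p R k ^ l (k + 1) * δ ≤ rho p ^ (k₀ - k) := by
    intro k hk hkk
    have hX := hXpos k hk
    rw [mul_comm, ← le_div_iff₀ hX]
    refine ciSup_le fun i => ?_
    have hRi := hR.1.pos (show 1 ≤ k₀ + 1 + i by omega)
    have h := h33 (k₀ + 1 + i) (by omega) (k + 1) (by omega) (by omega)
    rw [Nat.add_sub_cancel] at h
    simp only [hg]
    rw [div_le_iff₀ (by positivity)]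
    calc ε (k₀ + 1 + i) ≤ _ := h.le
      _ = rho p ^ (k₀ + 1 + i - (k + 1)) * (R (k₀ + 1 + i) ^ 2 *
          (R k * Sse p R k * lam p R k ^ l (k + 1))⁻¹) := by
        rw [mul_inv (R k * Sse p R k)]
        ring
      _ ≤ rho p ^ (k₀ - k) * (R (k₀ + 1 + i) ^ 2 *
          (R k * Sse p R k * lam p R k ^ l (k + 1))⁻¹) := by
        refine mul_le_mul_of_nonneg_right
          (pow_le_pow_of_le_one hρ0.le hρ1.le (by omega)) (by positivity)
      _ = _ := by ring
  have hXm : ∀ k, 1 ≤ k → k < k₀ →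
      R k * Sse p R k * lam p R k ^ l (k + 1) ≤ rho p ^ 2 * p ^ m (k + 1) := by
    intro k hk hkk
    have hp0 : (0 : ℝ) < p := by exact_mod_cast (by omega : 0 < p)
    have h := h34 (k + 1) (by omega) (by omega)
    rw [Nat.add_sub_cancel, ← div_eq_mul_inv, div_lt_one (by positivity), mul_assoc,
      inv_mul_lt_iff₀ (by positivity)] at h
    exact h.le
  obtain ⟨hc', heq, hlt⟩ := hc'
  have hδ : ∀ j, 1 ≤ j → ‖c' j - c j‖ ≤ δ * R j ^ 2 := by
    intro j hj
    have hRj := hR.1.pos hj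
    rcases Nat.lt_or_ge j (k₀ + 1) with h | h
    · rw [heq j hj h, sub_self, norm_zero]
      positivity
    · obtain ⟨i, rfl⟩ := Nat.exists_eq_add_of_le h
      rw [← div_le_iff₀ (by positivity)]
      refine le_trans ?_ (hgδ i)
      simp only [hg]
      gcongr
      exact (hlt _ h).le
  intro z
  exact ⟨cylinder_subset hpK hR hk₀ hm hl hc hc' (fun j hj hjk => heq j hj (by omega)) hδ0 hδ hS
      hδR hδX hXm,
    cylinder_subset hpK hR hk₀ hm hl hc' hc (fun j hj hjk => (heq j hj (by omega)).symm) hδ0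
      (fun j hj => by rw [norm_sub_rev]; exact hδ j hj) hS hδR hδX hXm⟩
end
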